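/- Let C5 be the cycle graph on 5 vertices. For every integer i ≥ 1, the i-fold lexicographic power C5^{*i} (a graph on n = 5^i vertices) realizes a ((k,n)) qQSS* access structure with k = 5^i − 3^i + 1, i.e. every subset B of its vertex set with |B| = 5^i − 3^i + 1 is strongly accessing. -/

import Mathlib

open Finset

/-- The odd neighborhood of a set `D` of vertices: the set of vertices having an odd
number of neighbors in `D`. -/
def oddNbhd {V : Type*} (G : SimpleGraph V) [Fintype V] [DecidableEq V]
    [DecidableRel G.Adj] (D : Finset V) : Finset V :=
  Finset.univ.filter fun v => Odd ((G.neighborFinset v) ∩ D).card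

/-- `B` is accessing: some `D ⊆ B` of odd cardinality has `Odd(D) ⊆ B`. -/
def accessing {V : Type*} (G : SimpleGraph V) [Fintype V] [DecidableEq V]
    [DecidableRel G.Adj] (B : Finset V) : Prop :=
  ∃ D ⊆ B, Odd D.card ∧ oddNbhd G D ⊆ B

/-- `B` is strongly accessing: it is accessing and moreover some `C ⊆ B` has
`V \ B ⊆ Odd(C)`. -/
def stronglyAccessing {V : Type*} (G : SimpleGraph V) [Fintype V] [DecidableEq V]
    [DecidableRel G.Adj] (B : Finset V) : Prop :=
  accessing G B ∧ ∃ C ⊆ B, Bᶜ ⊆ oddNbhd G C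

/-- The `i`-fold lexicographic power of `G`, on vertex set `Fin i → V`:
two tuples are adjacent iff at some coordinate `j` they are adjacent in `G`
while agreeing on all earlier coordinates.  This is the `i`-fold iteration
of the lexicographic product `G * G * ⋯ * G`. -/
def lexPow {V : Type*} (G : SimpleGraph V) (i : ℕ) : SimpleGraph (Fin i → V) where
  Adj x y := ∃ j : Fin i, (∀ l, l < j → x l = y l) ∧ G.Adj (x j) (y j)
  symm := by
    constructor
    rintro x y ⟨j, hpre, hadj⟩
    exact ⟨j, fun l hl => (hpre l hl).symm, hadj.symm⟩
  loopless := by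
    constructor
    rintro x ⟨j, _, hadj⟩
    exact G.loopless.irrefl _ hadj

instance {V : Type*} [DecidableEq V] (G : SimpleGraph V) [DecidableRel G.Adj] (i : ℕ) :
    DecidableRel (lexPow G i).Adj := fun x y =>
  inferInstanceAs (Decidable (∃ j : Fin i, (∀ l, l < j → x l = y l) ∧ G.Adj (x j) (y j)))

lemma lexPow_adj_cons {V : Type*} (G : SimpleGraph V) (i : ℕ) (u v : V) (x y : Fin i → V) :
    (lexPow G (i+1)).Adj (Fin.cons u x : Fin (i+1) → V) (Fin.cons v y : Fin (i+1) → V) ↔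
      G.Adj u v ∨ (u = v ∧ (lexPow G i).Adj x y) := by
  constructor
  · rintro ⟨j, hp, ha⟩
    induction j using Fin.cases with
    | zero => left; simpa using ha
    | succ j =>
      right
      refine ⟨by simpa using hp 0 (Fin.succ_pos j), j, fun l hl => ?_, by simpa using ha⟩
      simpa using hp l.succ (Fin.succ_lt_succ_iff.2 hl)
  · rintro (h | ⟨h, j, hp, ha⟩)
    · exact ⟨0, fun l hl => absurd hl (Fin.not_lt_zero l), by simpa using h⟩
    · refine ⟨j.succ, fun l hl => ?_, by simpa using ha⟩
      induction l using Fin.cases with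
      | zero => simpa using h
      | succ l => simpa using hp l (Fin.succ_lt_succ_iff.1 hl)

/-- All pairs (parity of the set, common value of the odd neighbourhood on `A`) are
realized by sets disjoint from `A`. -/
def Flex {V : Type*} (G : SimpleGraph V) [Fintype V] [DecidableEq V]
    [DecidableRel G.Adj] (A : Finset V) : Prop :=
  ∀ p s : ZMod 2, ∃ f : V → ZMod 2, (∀ x ∈ A, f x = 0) ∧ ∑ x, f x = p ∧
    ∀ x ∈ A, ∑ y, (if G.Adj x y then f y else 0) = s

set_option maxRecDepth 100000 in
set_option maxHeartbeats 4000000 in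
lemma flex_base : ∀ A : Finset (Fin 5), A.card ≤ 2 → Flex (SimpleGraph.cycleGraph 5) A := by
  unfold Flex
  decide +kernel

lemma sum_cons {i : ℕ} (F : (Fin (i+1) → Fin 5) → ZMod 2) :
    ∑ z, F z = ∑ u : Fin 5, ∑ x : Fin i → Fin 5, F (Fin.cons u x : Fin (i+1) → Fin 5) := by
  rw [← Fintype.sum_prod_type']
  exact (Fintype.sum_equiv (Fin.consEquiv (fun _ => Fin 5)) _ _ (fun x => rfl)).symm

lemma flex_all : ∀ (i : ℕ) (A : Finset (Fin i → Fin 5)), A.card < 3 ^ i →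
    Flex (lexPow (SimpleGraph.cycleGraph 5) i) A := by
  intro i
  induction i with
  | zero =>
    intro A hA p s
    have : A = ∅ := by simpa using hA
    subst this
    exact ⟨fun _ => p, by simp, by simp, by simp⟩
  | succ i ih =>
    intro A hA p s
    let fib : Fin 5 → Finset (Fin i → Fin 5) := fun u =>
      univ.filter fun x => (Fin.cons u x : Fin (i+1) → Fin 5) ∈ A
    let bad : Finset (Fin 5) := univ.filter fun u => 3 ^ i ≤ (fib u).card
    have hsum : ∑ u, (fib u).card ≤ A.card := by
      rw [← Finset.card_sigma]
      refine Finset.card_le_card_of_injOn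
        (fun z => (Fin.cons z.1 z.2 : Fin (i+1) → Fin 5)) ?_ ?_
      · intro z hz
        simpa [fib] using hz
      · rintro ⟨u, x⟩ _ ⟨v, y⟩ _ h
        have h' := Fin.cons_injective2 h
        obtain ⟨rfl, rfl⟩ := h'
        rfl
    have hbad : bad.card ≤ 2 := by
      have h1 : bad.card * 3 ^ i ≤ ∑ u ∈ bad, (fib u).card := by
        rw [← smul_eq_mul]
        exact Finset.card_nsmul_le_sum _ _ _ (fun u hu => (Finset.mem_filter.1 hu).2)
      have h2 : ∑ u ∈ bad, (fib u).card ≤ ∑ u, (fib u).card :=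
        Finset.sum_le_sum_of_subset (Finset.subset_univ _)
      by_contra hc
      have h3 : 3 * 3 ^ i ≤ bad.card * 3 ^ i := Nat.mul_le_mul_right _ (by omega)
      rw [pow_succ] at hA
      omega
    obtain ⟨f0, hf0, hp0, hs0⟩ := flex_base bad hbad p s
    have key : ∀ u, ∃ f : (Fin i → Fin 5) → ZMod 2, (∀ x ∈ fib u, f x = 0) ∧
        ∑ x, f x = f0 u ∧ ∀ x ∈ fib u,
          ∑ y, (if (lexPow (SimpleGraph.cycleGraph 5) i).Adj x y then f y else 0) =
          s - ∑ v, (if (SimpleGraph.cycleGraph 5).Adj u v then f0 v else 0) := by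
      intro u
      by_cases hu : u ∈ bad
      · refine ⟨fun _ => 0, by simp, by simp [hf0 u hu], fun x _ => ?_⟩
        rw [hs0 u hu]; simp
      · exact ih (fib u) (by simpa [bad] using hu) _ _
    choose f hfA hfp hfs using key
    refine ⟨fun z => f (z 0) (Fin.tail z), ?_, ?_, ?_⟩
    · intro z hz
      apply hfA
      simpa [fib] using hz
    · rw [sum_cons]
      simp [hfp, hp0]
    · intro z hz
      induction z using Fin.consCases with
      | _ u x =>
      have hx : x ∈ fib u := by simpa [fib] using hz
      rw [sum_cons]
      have step : ∀ v : Fin 5, (∑ y : Fin i → Fin 5,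
          (if (lexPow (SimpleGraph.cycleGraph 5) (i+1)).Adj (Fin.cons u x : Fin (i+1) → Fin 5)
            (Fin.cons v y : Fin (i+1) → Fin 5) then
            f ((Fin.cons v y : Fin (i+1) → Fin 5) 0) (Fin.tail (Fin.cons v y : Fin (i+1) → Fin 5))
            else 0)) =
          (if (SimpleGraph.cycleGraph 5).Adj u v then f0 v else 0) +
          (if u = v then ∑ y, (if (lexPow (SimpleGraph.cycleGraph 5) i).Adj x y
            then f u y else 0) else 0) := by
        intro v
        simp only [lexPow_adj_cons, Fin.cons_zero, Fin.tail_cons]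
        by_cases huv : u = v
        · subst huv; simp
        · by_cases ha : (SimpleGraph.cycleGraph 5).Adj u v
          · simp [ha, huv, hfp]
          · simp [ha, huv]
      rw [Finset.sum_congr rfl (fun v _ => step v), Finset.sum_add_distrib,
        Finset.sum_ite_eq, if_pos (Finset.mem_univ _), hfs u x hx]
      ring

lemma mem_oddNbhd_iff {V : Type*} (G : SimpleGraph V) [Fintype V] [DecidableEq V]
    [DecidableRel G.Adj] (f : V → ZMod 2) (v : V) :
    v ∈ oddNbhd G (univ.filter fun x => f x = 1) ↔
      ∑ y, (if G.Adj v y then f y else 0) = 1 := by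
  have h : ∀ a : ZMod 2, a = if a = 1 then 1 else 0 := by decide
  have : ∑ y, (if G.Adj v y then f y else 0) =
      (((G.neighborFinset v) ∩ (univ.filter fun x => f x = 1)).card : ZMod 2) := by
    rw [Finset.card_eq_sum_ones, Nat.cast_sum, ← Finset.filter_mem_eq_inter,
      Finset.sum_filter, SimpleGraph.neighborFinset_eq_filter, Finset.sum_filter]
    refine Finset.sum_congr rfl fun y _ => ?_
    by_cases ha : G.Adj v y
    · simpa [ha] using h (f y)
    · simp [ha]
  rw [this, ZMod.natCast_eq_one_iff_odd]
  simp [oddNbhd]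

lemma flex_strong {V : Type*} (G : SimpleGraph V) [Fintype V] [DecidableEq V]
    [DecidableRel G.Adj] (B : Finset V) (h : Flex G Bᶜ) : stronglyAccessing G B := by
  have hsub : ∀ f : V → ZMod 2, (∀ x ∈ Bᶜ, f x = 0) → (univ.filter fun x => f x = 1) ⊆ B := by
    intro f hf x hx
    by_contra hxB
    have := hf x (by simpa using hxB)
    simp [this] at hx
  refine ⟨?_, ?_⟩
  · obtain ⟨f, h1, h2, h3⟩ := h 1 0
    refine ⟨_, hsub f h1, ?_, ?_⟩
    · rw [← ZMod.natCast_eq_one_iff_odd]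
      refine Eq.trans ?_ h2
      rw [Finset.card_eq_sum_ones, Nat.cast_sum, Finset.sum_filter]
      have h : ∀ a : ZMod 2, (if a = 1 then ((1:ℕ) : ZMod 2) else 0) = a := by decide
      exact Finset.sum_congr rfl fun y _ => h (f y)
    · intro v hv
      by_contra hvB
      rw [mem_oddNbhd_iff, h3 v (by simpa using hvB)] at hv
      exact absurd hv (by decide)
  · obtain ⟨f, h1, h2, h3⟩ := h 0 1
    exact ⟨_, hsub f h1, fun v hv => (mem_oddNbhd_iff G f v).2 (h3 v hv)⟩

/-- For every `i ≥ 1`, the `i`-fold lexicographic power of the cycle `C₅` (a graph on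
`5^i` vertices) realizes a `((5^i − 3^i + 1, 5^i))` qQSS* access structure: every set of
`5^i − 3^i + 1` vertices is strongly accessing. -/
theorem lexPow_cycleGraph_five_threshold :
    ∀ i : ℕ, 1 ≤ i →
      ∀ B : Finset (Fin i → Fin 5), B.card = 5 ^ i - 3 ^ i + 1 →
        stronglyAccessing (lexPow (SimpleGraph.cycleGraph 5) i) B := by
  intro i _ B hB
  apply flex_strong
  apply flex_all
  have h : 3 ^ i ≤ 5 ^ i := Nat.pow_le_pow_left (by norm_num) i
  have h3 : 0 < 3 ^ i := by positivity
  rw [Finset.card_compl, hB]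
  simp only [Fintype.card_pi, Fintype.card_fin, Finset.prod_const, Finset.card_univ]
  omega
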